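/- Let V be a complex vector space of dimension n+1 with n ≥ 2. Fix a nonzero vector e ∈ V and a nonzero linear functional α ∈ V* with α(e) = 0. Define linear maps Φ_v, σ : V ⊗ V → (⋀²V) ⊗ V by Φ_v(x ⊗ y) = (x ∧ v) ⊗ y + (y ∧ v) ⊗ x and σ(x ⊗ y) = (α(x)(e ∧ y) + α(y)(e ∧ x)) ⊗ e. Then: (1) for every v ∈ V and every t ∈ ℂ with v ≠ 0, the symmetric tensor t·α(v)·(e ⊗ e) − v ⊗ v is a nonzero element of the kernel of Φ_v + t·σ; (2) consequently, restricting all maps to the subspace Sym²V of symmetric tensors of V ⊗ V, every element of the linear span of {Φ_v|_{Sym²V} : v ∈ V} ∪ {σ|_{Sym²V}} has rank at most (n²+3n)/2, σ|_{Sym²V} does not lie in {Φ_v|_{Sym²V} : v ∈ V}, and hence the space {Φ_v|_{Sym²V} : v ∈ V} is not rank-critical. -/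

import Mathlib

open Module LinearMap ExteriorAlgebra TensorProduct

/-- The second exterior power `⋀²V`, as a submodule of the exterior algebra. -/
noncomputable def extSq (V : Type*) [AddCommGroup V] [Module ℂ V] :
    Submodule ℂ (ExteriorAlgebra ℂ V) := ⋀[ℂ]^2 V

/-- The subspace `Sym²V ⊆ V ⊗ V` of symmetric tensors. -/
noncomputable def symSq (V : Type*) [AddCommGroup V] [Module ℂ V] :
    Submodule ℂ (V ⊗[ℂ] V) :=
  Submodule.span ℂ {t : V ⊗[ℂ] V | ∃ x y : V, t = x ⊗ₜ[ℂ] y + y ⊗ₜ[ℂ] x}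

variable {V : Type*} [AddCommGroup V] [Module ℂ V]

/-- The wedge product `V × V → ⋀²V` as a bilinear map. -/
noncomputable def wedge2 : V →ₗ[ℂ] V →ₗ[ℂ] extSq V :=
  LinearMap.mk₂ ℂ
    (fun x y => ⟨ι ℂ x * ι ℂ y, by
      have h := Submodule.mul_mem_mul
        (LinearMap.mem_range_self (ι ℂ : V →ₗ[ℂ] ExteriorAlgebra ℂ V) x)
        (LinearMap.mem_range_self (ι ℂ : V →ₗ[ℂ] ExteriorAlgebra ℂ V) y)
      rwa [← pow_two] at h⟩)
    (fun x x' y => Subtype.ext <| by simp [add_mul])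
    (fun c x y => Subtype.ext <| by simp [smul_mul_assoc])
    (fun x y y' => Subtype.ext <| by simp [mul_add])
    (fun c x y => Subtype.ext <| by simp [mul_smul_comm])

/-- The linear map `Φ_v : V ⊗ V → (⋀²V) ⊗ V` determined by
`Φ_v(x ⊗ y) = (x ∧ v) ⊗ y + (y ∧ v) ⊗ x`. -/
noncomputable def Phi (v : V) : V ⊗[ℂ] V →ₗ[ℂ] (extSq V) ⊗[ℂ] V :=
  TensorProduct.lift <| LinearMap.mk₂ ℂ
    (fun x y => wedge2 x v ⊗ₜ[ℂ] y + wedge2 y v ⊗ₜ[ℂ] x)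
    (fun x x' y => by
      simp only [map_add, LinearMap.add_apply, add_tmul, tmul_add]; abel)
    (fun c x y => by
      simp only [map_smul, LinearMap.smul_apply, smul_tmul', tmul_smul, smul_add])
    (fun x y y' => by
      simp only [map_add, LinearMap.add_apply, add_tmul, tmul_add]; abel)
    (fun c x y => by
      simp only [map_smul, LinearMap.smul_apply, smul_tmul', tmul_smul, smul_add])

/-- The linear map `σ : V ⊗ V → (⋀²V) ⊗ V` determined by
`σ(x ⊗ y) = (α(x)(e ∧ y) + α(y)(e ∧ x)) ⊗ e`. -/
noncomputable def sigmaMap (e : V) (α : Module.Dual ℂ V) :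
    V ⊗[ℂ] V →ₗ[ℂ] (extSq V) ⊗[ℂ] V :=
  TensorProduct.lift <| LinearMap.mk₂ ℂ
    (fun x y => (α x • wedge2 e y + α y • wedge2 e x) ⊗ₜ[ℂ] e)
    (fun x x' y => by
      simp only [map_add, smul_add, add_smul, add_tmul]; abel)
    (fun c x y => by
      simp only [map_smul, smul_eq_mul, smul_smul, add_tmul, smul_tmul', smul_add, mul_comm])
    (fun x y y' => by
      simp only [map_add, smul_add, add_smul, add_tmul]; abel)
    (fun c x y => by
      simp only [map_smul, smul_eq_mul, smul_smul, add_tmul, smul_tmul', smul_add, mul_comm])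

theorem eq_zero_or_eq_zero_of_tmul_eq_zero {K M N : Type*} [Field K] [AddCommGroup M]
    [Module K M] [AddCommGroup N] [Module K N] {m : M} {x : N} (h : m ⊗ₜ[K] x = 0) :
    m = 0 ∨ x = 0 := by
  refine or_iff_not_imp_left.mpr fun hm => (Module.forall_dual_apply_eq_zero_iff K x).mp fun β => ?_
  have h' := congrArg (fun u => TensorProduct.rid K M (TensorProduct.map LinearMap.id β u)) h
  simpa [hm] using h'

theorem Phi_tmul (v x y : V) :
    Phi v (x ⊗ₜ[ℂ] y) = wedge2 x v ⊗ₜ[ℂ] y + wedge2 y v ⊗ₜ[ℂ] x := rfl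

theorem sigmaMap_tmul (e : V) (α : Module.Dual ℂ V) (x y : V) :
    sigmaMap e α (x ⊗ₜ[ℂ] y) = (α x • wedge2 e y + α y • wedge2 e x) ⊗ₜ[ℂ] e := rfl

theorem wedge2_self (x : V) : wedge2 x x = 0 :=
  Subtype.ext (ι_sq_zero x)

theorem wedge2_ne_zero {e x : V} {α : Module.Dual ℂ V} (he : e ≠ 0) (hαe : α e = 0)
    (hx : α x = 1) : wedge2 e x ≠ 0 := by
  intro h
  have h₁ : ι ℂ e * ι ℂ x = 0 := congrArg Subtype.val h
  have h₂ : CliffordAlgebra.contractLeft (Q := (0 : QuadraticForm ℂ V)) α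
      (CliffordAlgebra.ι 0 e * CliffordAlgebra.ι 0 x) = 0 :=
    (congrArg _ h₁).trans (map_zero _)
  rw [CliffordAlgebra.contractLeft_ι_mul, CliffordAlgebra.contractLeft_ι, hαe, hx, zero_smul,
    map_one, mul_one, zero_sub, neg_eq_zero] at h₂
  exact he (ι_eq_zero_iff (R := ℂ) e |>.mp h₂)

theorem tmul_self_mem_symSq (x : V) : x ⊗ₜ[ℂ] x ∈ symSq V := by
  have h : x ⊗ₜ[ℂ] x + x ⊗ₜ[ℂ] x ∈ symSq V := Submodule.subset_span ⟨x, x, rfl⟩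
  rw [← two_smul ℂ] at h
  exact (Submodule.smul_mem_iff _ two_ne_zero).mp h

/-- `v ↦ Φ_v`, restricted to symmetric tensors, as a linear map. -/
noncomputable def phiSym :
    V →ₗ[ℂ] symSq V →ₗ[ℂ] (extSq V) ⊗[ℂ] V where
  toFun v := (Phi v).domRestrict (symSq V)
  map_add' v w := by
    have h : Phi (v + w) = Phi v + Phi w := TensorProduct.ext' fun x y => by
      simp only [LinearMap.add_apply, Phi_tmul, map_add, add_tmul]; abel
    rw [h]; rfl
  map_smul' c v := by
    have h : Phi (c • v) = c • Phi v := TensorProduct.ext' fun x y => by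
      simp only [LinearMap.smul_apply, Phi_tmul, map_smul, smul_add, smul_tmul']
    rw [h]; rfl

theorem finrank_symSq_le [FiniteDimensional ℂ V] :
    finrank ℂ (symSq V) ≤ (finrank ℂ V + 1).choose 2 := by
  let b := finBasis ℂ V
  let g : Sym2 (Fin (finrank ℂ V)) → V ⊗[ℂ] V :=
    Sym2.lift ⟨fun i j => b i ⊗ₜ[ℂ] b j + b j ⊗ₜ[ℂ] b i, fun i j => add_comm _ _⟩
  have hle : symSq V ≤ Submodule.span ℂ (Set.range g) := by
    refine Submodule.span_le.mpr ?_
    rintro _ ⟨x, y, rfl⟩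
    have key : x ⊗ₜ[ℂ] y + y ⊗ₜ[ℂ] x =
        ∑ i, ∑ j, (b.repr x i * b.repr y j) • g s(i, j) := by
      conv_lhs => rw [← b.sum_repr x, ← b.sum_repr y]
      simp only [g, Sym2.lift_mk, TensorProduct.sum_tmul, TensorProduct.tmul_sum, smul_add,
        Finset.sum_add_distrib, TensorProduct.smul_tmul_smul]
      congr 1
      rw [Finset.sum_comm]
      simp only [mul_comm]
    rw [key]
    exact Submodule.sum_mem _ fun i _ => Submodule.sum_mem _ fun j _ =>
      Submodule.smul_mem _ _ (Submodule.subset_span ⟨_, rfl⟩)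
  calc finrank ℂ (symSq V) ≤ finrank ℂ (Submodule.span ℂ (Set.range g)) :=
        Submodule.finrank_mono hle
    _ ≤ Fintype.card (Sym2 (Fin (finrank ℂ V))) := finrank_range_le_card g
    _ = (finrank ℂ V + 1).choose 2 := by rw [Sym2.card, Fintype.card_fin]

theorem finrank_range_lt_of_mem_ker {K M N P Q : Type*} [Field K] [AddCommGroup M] [Module K M]
    [AddCommGroup N] [Module K N] [AddCommGroup P] [Module K P] [AddCommGroup Q] [Module K Q]
    {S : Submodule K (M ⊗[K] N)} [Module.Finite K S] (f : S →ₗ[K] P ⊗[K] Q) {z : S}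
    (hz : z ≠ 0) (hf : f z = 0) : finrank K (LinearMap.range f) < finrank K S := by
  have h := f.finrank_range_add_finrank_ker
  have : Nontrivial (LinearMap.ker f) := ⟨⟨z, hf⟩, 0, fun h => hz (congrArg Subtype.val h)⟩
  have := finrank_pos (R := K) (M := LinearMap.ker f)
  omega

theorem smul_tmul_self_sub_tmul_self_mem_symSq (e v : V) (c : ℂ) :
    c • (e ⊗ₜ[ℂ] e) - v ⊗ₜ[ℂ] v ∈ symSq V :=
  Submodule.sub_mem _ (Submodule.smul_mem _ _ (tmul_self_mem_symSq e)) (tmul_self_mem_symSq v)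

theorem smul_tmul_self_sub_tmul_self_ne_zero {e v : V} {α : Module.Dual ℂ V} (hαe : α e = 0)
    (hv : v ≠ 0) (t : ℂ) : (t * α v) • (e ⊗ₜ[ℂ] e) - v ⊗ₜ[ℂ] v ≠ 0 := by
  intro h
  have h₁ := congrArg (LinearMap.mul' ℂ ℂ ∘ₗ TensorProduct.map α α) h
  have hαv : α v = 0 := by simpa [hαe] using h₁
  rw [hαv, mul_zero, zero_smul, zero_sub, neg_eq_zero] at h
  exact hv ((eq_zero_or_eq_zero_of_tmul_eq_zero h).elim id id)

theorem Phi_add_smul_sigmaMap_apply {e : V} {α : Module.Dual ℂ V} (hαe : α e = 0) (v : V)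
    (t : ℂ) : (Phi v + t • sigmaMap e α) ((t * α v) • (e ⊗ₜ[ℂ] e) - v ⊗ₜ[ℂ] v) = 0 := by
  simp only [map_sub, map_smul, LinearMap.add_apply, LinearMap.smul_apply, Phi_tmul,
    sigmaMap_tmul, wedge2_self, hαe, zero_tmul, add_zero, smul_zero, add_tmul,
    ← smul_tmul']
  module

theorem sigmaMap_domRestrict_ne {e : V} {α : Module.Dual ℂ V} (he : e ≠ 0) (hα : α ≠ 0)
    (hαe : α e = 0) (w : V) :
    (Phi w).domRestrict (symSq V) ≠ (sigmaMap e α).domRestrict (symSq V) := by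
  intro h
  obtain ⟨x, hx⟩ := LinearMap.surjective hα 1
  have h₁ : Phi w (x ⊗ₜ[ℂ] x) = sigmaMap e α (x ⊗ₜ[ℂ] x) :=
    LinearMap.congr_fun h ⟨_, tmul_self_mem_symSq x⟩
  rw [Phi_tmul, sigmaMap_tmul, hx, one_smul, ← two_smul ℂ, ← two_smul ℂ] at h₁
  have h₂ := congrArg (fun u => TensorProduct.rid ℂ (extSq V) (TensorProduct.map LinearMap.id α u)) h₁
  have hxw : wedge2 x w = 0 := by simpa [hx, hαe] using h₂
  rw [hxw, zero_tmul, smul_zero, eq_comm] at h₁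
  exact (eq_zero_or_eq_zero_of_tmul_eq_zero h₁).elim (smul_ne_zero two_ne_zero (wedge2_ne_zero he hαe hx)) he

theorem finrank_range_le_of_mem_span [FiniteDimensional ℂ V] {n : ℕ} (hV : finrank ℂ V = n + 1)
    {e : V} (he : e ≠ 0) {α : Module.Dual ℂ V} (hαe : α e = 0)
    {f : symSq V →ₗ[ℂ] (extSq V) ⊗[ℂ] V}
    (hf : f ∈ Submodule.span ℂ (Set.range (fun v : V => (Phi v).domRestrict (symSq V)) ∪
      {(sigmaMap e α).domRestrict (symSq V)})) :
    finrank ℂ (LinearMap.range f) ≤ (n ^ 2 + 3 * n) / 2 := by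
  have hrange : Set.range (fun v : V => (Phi v).domRestrict (symSq V)) =
      LinearMap.range (phiSym (V := V)) := rfl
  rw [hrange, Submodule.span_union, Submodule.span_eq] at hf
  obtain ⟨_, ⟨v, rfl⟩, _, ht, rfl⟩ := Submodule.mem_sup.mp hf
  obtain ⟨t, rfl⟩ := Submodule.mem_span_singleton.mp ht
  have hker : ∃ z : symSq V, z ≠ 0 ∧
      (phiSym v + t • (sigmaMap e α).domRestrict (symSq V)) z = 0 := by
    by_cases hv : v = 0
    · refine ⟨⟨e ⊗ₜ[ℂ] e, tmul_self_mem_symSq e⟩, ?_, ?_⟩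
      · intro h
        have h' := congrArg Subtype.val h
        exact he ((eq_zero_or_eq_zero_of_tmul_eq_zero h').elim id id)
      · rw [hv, map_zero, zero_add, LinearMap.smul_apply, LinearMap.domRestrict_apply,
          sigmaMap_tmul, hαe, zero_smul, zero_add, zero_tmul, smul_zero]
    · exact ⟨⟨_, smul_tmul_self_sub_tmul_self_mem_symSq e v (t * α v)⟩,
        fun h => smul_tmul_self_sub_tmul_self_ne_zero hαe hv t (congrArg Subtype.val h),
        Phi_add_smul_sigmaMap_apply hαe v t⟩
  obtain ⟨z, hz, hfz⟩ := hker
  have h₁ := finrank_range_lt_of_mem_ker _ hz hfz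
  have h₂ := finrank_symSq_le (V := V)
  have h₃ : (n + 1 + 1).choose 2 = (n ^ 2 + 3 * n) / 2 + 1 := by
    rw [Nat.choose_two_right, Nat.add_sub_cancel,
      show (n + 1 + 1) * (n + 1) = n ^ 2 + 3 * n + 1 * 2 by ring,
      Nat.add_mul_div_right _ _ two_pos]
  rw [hV, h₃] at h₂
  omega

set_option maxHeartbeats 800000 in
/-- With `dim V = n + 1 ≥ 3`, `e ≠ 0` and `α` a nonzero linear form with `α(e) = 0`:
(1) for all `v ≠ 0` and `t ∈ ℂ`, the symmetric tensor `t·α(v)·(e ⊗ e) − v ⊗ v` is a nonzero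
element of the kernel of `Φ_v + t·σ`; (2) on the subspace `Sym²V` of symmetric tensors, every
element of the span of the restricted maps `Φ_v|` together with `σ|` has rank at most
`(n²+3n)/2`, `σ|` is not one of the `Φ_v|`, and therefore the space `{Φ_v| : v ∈ V}` is not
rank-critical. -/
theorem sigma_kernel_and_not_rank_critical
    [FiniteDimensional ℂ V] {n : ℕ} (hV : finrank ℂ V = n + 1) (hn : 2 ≤ n)
    (e : V) (he : e ≠ 0) (α : Module.Dual ℂ V) (hα : α ≠ 0) (hαe : α e = 0) :
    (∀ (v : V) (t : ℂ), v ≠ 0 →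
        ((t * α v) • (e ⊗ₜ[ℂ] e) - v ⊗ₜ[ℂ] v) ∈ symSq V ∧
        ((t * α v) • (e ⊗ₜ[ℂ] e) - v ⊗ₜ[ℂ] v) ≠ 0 ∧
        (Phi v + t • sigmaMap e α) ((t * α v) • (e ⊗ₜ[ℂ] e) - v ⊗ₜ[ℂ] v) = 0) ∧
      (∀ f ∈ Submodule.span ℂ
          (Set.range (fun v : V => (Phi v).domRestrict (symSq V)) ∪
            {(sigmaMap e α).domRestrict (symSq V)}),
        finrank ℂ (LinearMap.range f) ≤ (n ^ 2 + 3 * n) / 2) ∧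
      (sigmaMap e α).domRestrict (symSq V) ∉
        Set.range (fun v : V => (Phi v).domRestrict (symSq V)) ∧
      ¬ (∀ L' : Submodule ℂ (symSq V →ₗ[ℂ] (extSq V) ⊗[ℂ] V),
          Submodule.span ℂ (Set.range (fun v : V => (Phi v).domRestrict (symSq V))) < L' →
            ∃ B ∈ L', (n ^ 2 + 3 * n) / 2 < finrank ℂ (LinearMap.range B)) := by
  have hspan := fun f hf => finrank_range_le_of_mem_span hV he hαe (f := f) hf
  refine ⟨fun v t hv => ⟨smul_tmul_self_sub_tmul_self_mem_symSq e v _,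
    smul_tmul_self_sub_tmul_self_ne_zero hαe hv t, Phi_add_smul_sigmaMap_apply hαe v t⟩,
    hspan, fun ⟨w, hw⟩ => sigmaMap_domRestrict_ne he hα hαe w hw, fun hcrit => ?_⟩
  have hnot_mem : (sigmaMap e α).domRestrict (symSq V) ∉
      Submodule.span ℂ (Set.range (fun v : V => (Phi v).domRestrict (symSq V))) := fun h => by
    have hmem : (sigmaMap e α).domRestrict (symSq V) ∈ LinearMap.range (phiSym (V := V)) :=
      Submodule.span_le.mpr (fun _ h => h) h
    obtain ⟨w, hw⟩ := hmem
    exact sigmaMap_domRestrict_ne he hα hαe w hw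
  obtain ⟨B, hB, hlt⟩ := hcrit (Submodule.span ℂ
      (Set.range (fun v : V => (Phi v).domRestrict (symSq V)) ∪
        {(sigmaMap e α).domRestrict (symSq V)}))
    (SetLike.lt_iff_le_and_exists.mpr ⟨Submodule.span_mono Set.subset_union_left, _,
      Submodule.subset_span (Or.inr rfl), hnot_mem⟩)
  exact hlt.not_ge (hspan B hB)
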